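/- arXiv:2209.14978 — 2 statements merged into one kernel-verified Lean document; each statement's English description precedes it below -/
import Mathlib

section
/- Let k, s be positive integers with k ≤ 2s and s ≤ k−2, and set w_+ = k + √(k² − 4(k−s)(k−s−1)) and w_− = k − √(k² − 4(k−s)(k−s−1)) (real numbers; the discriminant is positive under these hypotheses). Then for every n ≥ 1, the number of vertices satisfies the closed formula (b_n^{(k,s)} : ℝ) = (1/2^{n+1}) · ( w_−^n + w_+^n + (2k/(w_+ − w_−)) · (w_+^n − w_−^n) ). -/
open Pointwise

/-- The window `λ_i = {s·i, …, s·i+k−1}` simplex-sum polytope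
`P_{n,k,s} = Δ_{λ_0} + ⋯ + Δ_{λ_{n-1}} ⊆ ℝ^K`, `K = s(n−1)+k`. -/
noncomputable def poolPolytope (n k s : ℕ) : Set (Fin (s * (n - 1) + k) → ℝ) :=
  ∑ i ∈ Finset.range n,
    convexHull ℝ {v : Fin (s * (n - 1) + k) → ℝ |
      ∃ j : Fin (s * (n - 1) + k), s * i ≤ (j : ℕ) ∧ (j : ℕ) < s * i + k ∧
        v = Pi.single j (1 : ℝ)}

/-- `b_n^{(k,s)}`, the number of vertices (extreme points) of `P_{n,k,s}`. -/
noncomputable def numVertices (n k s : ℕ) : ℕ :=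
  Nat.card (Set.extremePoints ℝ (poolPolytope n k s))

/-- If a linear functional attains its maximum over `V` only at `x`, then `x` is an extreme point
of the convex hull of `V`. -/
theorem mem_extremePoints_convexHull_of_forall_lt {E : Type*} [AddCommGroup E] [Module ℝ E]
    {V : Set E} {x : E} (hx : x ∈ V) (L : E →ₗ[ℝ] ℝ) (hL : ∀ y ∈ V, y ≠ x → L y < L x) :
    x ∈ Set.extremePoints ℝ (convexHull ℝ V) := by
  have hconv : Convex ℝ {y | L y < L x ∨ y = x} := by
    rw [convex_iff_forall_pos]
    rintro y hy z hz a b ha hb hab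
    rcases hy with hy | rfl
    · left
      have hz' : L z ≤ L x := by
        rcases hz with hz | rfl
        · exact hz.le
        · exact le_rfl
      simp only [map_add, map_smul, smul_eq_mul]
      calc a * L y + b * L z < a * L x + b * L x :=
            add_lt_add_of_lt_of_le (by gcongr) (by gcongr)
        _ = L x := by rw [← add_mul, hab, one_mul]
    · rcases hz with hz | rfl
      · left
        simp only [map_add, map_smul, smul_eq_mul]
        calc a * L y + b * L z < a * L y + b * L y := by gcongr
          _ = L y := by rw [← add_mul, hab, one_mul]
      · right
        rw [← add_smul, hab, one_smul]
  have hsub : convexHull ℝ V ⊆ {y | L y < L x ∨ y = x} :=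
    convexHull_min (fun y hy => (em (y = x)).elim Or.inr fun h => Or.inl (hL y hy h)) hconv
  refine ⟨subset_convexHull ℝ V hx, ?_⟩
  rintro y hy z hz ⟨a, b, ha, hb, hab, hxyz⟩
  rcases hsub hy with hy' | hy'
  · exfalso
    have hz' : L z ≤ L x := by
      rcases hsub hz with hz | rfl
      · exact hz.le
      · exact le_rfl
    have h : a * L y + b * L z = L x := by
      rw [← hxyz]; simp
    have : a * L y + b * L z < a * L x + b * L x :=
      add_lt_add_of_lt_of_le (by gcongr) (by gcongr)
    rw [← add_mul, hab, one_mul] at this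
    linarith
  · exact hy'

/-- The offsets `a` in one window and `b` in the next are in conflict: the selected elements are
distinct and both lie in both windows. -/
def IsConflict (k s a b : ℕ) : Prop := s ≤ a ∧ b + s < k ∧ a ≠ b + s

/-- A choice of one offset per window without conflicts between consecutive windows. -/
def IsConflictFree (k s : ℕ) {n : ℕ} (t : Fin n → Fin k) : Prop :=
  ∀ i (h : i + 1 < n), ¬ IsConflict k s (t ⟨i, by omega⟩) (t ⟨i + 1, h⟩)

/-- Heights attached to the windows: the height drops by one when the element selected in the next
window also lies in the current one, and rises by one in the opposite case. -/
def windowHeight (k s n : ℕ) (F : ℕ → ℕ) : ℕ → ℤ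
  | 0 => n
  | i + 1 =>
    if F (i + 1) < s * i + k ∧ F i ≠ F (i + 1) then windowHeight k s n F i - 1
    else if s * (i + 1) ≤ F i ∧ F i ≠ F (i + 1) then windowHeight k s n F i + 1
    else windowHeight k s n F i

theorem sub_le_windowHeight (k s n : ℕ) (F : ℕ → ℕ) (i : ℕ) :
    (n : ℤ) - i ≤ windowHeight k s n F i := by
  induction i with
  | zero => simp [windowHeight]
  | succ i ih =>
    simp only [windowHeight]
    push_cast
    split_ifs <;> omega

/-- A conflict-free selection is cut out by a weight function: in each window the selected element
is the unique one of maximal weight. -/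
theorem exists_weight {k s n : ℕ} (hks : k ≤ 2 * s) (F : ℕ → ℕ)
    (hF : ∀ i < n, s * i ≤ F i ∧ F i < s * i + k)
    (hfree : ∀ i, i + 1 < n → s * (i + 1) ≤ F i → F (i + 1) < s * i + k → F i = F (i + 1)) :
    ∃ c : ℕ → ℝ, ∀ i < n, ∀ j, s * i ≤ j → j < s * i + k → j ≠ F i → c j < c (F i) := by
  classical
  have near : ∀ i < n, ∀ i' < n, s * i ≤ F i' → F i' < s * i + k →
      i' = i ∨ i' = i + 1 ∨ i = i' + 1 := by
    intro i hi i' hi' h1 h2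
    by_contra! h
    obtain ⟨hF1, hF2⟩ := hF i' hi'
    rcases Nat.lt_or_ge i i' with hlt | hge
    · have : s * (i + 2) ≤ s * i' := Nat.mul_le_mul_left _ (by omega)
      rw [Nat.mul_add] at this
      omega
    · have : s * (i' + 2) ≤ s * i := Nat.mul_le_mul_left _ (by omega)
      rw [Nat.mul_add] at this
      omega
  have heq : ∀ i < n, ∀ i' < n, F i' = F i →
      windowHeight k s n F i' = windowHeight k s n F i := by
    intro i hi i' hi' h
    obtain ⟨hF1, hF2⟩ := hF i hi
    rcases near i hi i' hi' (h ▸ hF1) (h ▸ hF2) with rfl | rfl | rfl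
    · rfl
    · simp [windowHeight, h]
    · simp [windowHeight, h]
  let c : ℕ → ℝ := fun j =>
    if h : ∃ i, i < n ∧ F i = j then (windowHeight k s n F h.choose : ℝ) else 0
  have hc : ∀ i < n, c (F i) = windowHeight k s n F i := by
    intro i hi
    have h : ∃ i', i' < n ∧ F i' = F i := ⟨i, hi, rfl⟩
    simp only [c, dif_pos h]
    exact_mod_cast heq i hi _ h.choose_spec.1 h.choose_spec.2
  refine ⟨c, fun i hi j hj1 hj2 hj => ?_⟩
  by_cases h : ∃ i', i' < n ∧ F i' = j
  · obtain ⟨i', hi', rfl⟩ := h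
    rw [hc i hi, hc i' hi']
    norm_cast
    rcases near i hi i' hi' hj1 hj2 with rfl | rfl | rfl
    · exact absurd rfl hj
    · simp only [windowHeight, if_pos (And.intro hj2 hj.symm)]
      omega
    · have : ¬ (F (i' + 1) < s * i' + k ∧ F i' ≠ F (i' + 1)) :=
        fun h => h.2 (hfree i' hi hj1 h.1)
      simp only [windowHeight, if_neg this, if_pos (And.intro hj1 hj)]
      omega
  · rw [hc i hi]
    simp only [c, dif_neg h]
    have := sub_le_windowHeight k s n F i
    exact_mod_cast (by omega : 0 < windowHeight k s n F i)

/-- The element of offset `u` in the `i`-th window. -/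
def windowElem {n k : ℕ} (s : ℕ) (i : Fin n) (u : Fin k) : Fin (s * (n - 1) + k) :=
  ⟨s * i + u, by
    have : s * i ≤ s * (n - 1) := Nat.mul_le_mul_left _ (by omega)
    omega⟩

/-- The sum of the basis vectors selected by a choice of one offset per window. -/
def selectionSum {n k : ℕ} (s : ℕ) (t : Fin n → Fin k) : Fin (s * (n - 1) + k) → ℝ :=
  ∑ i, Pi.single (windowElem s i (t i)) 1

theorem poolPolytope_eq_convexHull (n k s : ℕ) :
    poolPolytope n k s =
      convexHull ℝ (Set.range (selectionSum s : (Fin n → Fin k) → _)) := by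
  rw [poolPolytope, Finset.sum_range, ← convexHull_sum]
  congr 1
  ext x
  rw [Set.mem_fintype_sum]
  constructor
  · rintro ⟨g, hg, rfl⟩
    choose j hj1 hj2 hj using hg
    refine ⟨fun i => ⟨j i - s * i, by have := hj1 i; have := hj2 i; omega⟩, ?_⟩
    refine Finset.sum_congr rfl fun i _ => ?_
    rw [hj i]
    congr 1
    ext
    have := hj1 i
    simp only [windowElem]
    omega
  · rintro ⟨t, rfl⟩
    exact ⟨fun i => Pi.single (windowElem s i (t i)) 1, fun i =>
      ⟨windowElem s i (t i), by simp [windowElem], by simp [windowElem], rfl⟩, rfl⟩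

theorem exists_linearMap_lt {n k s : ℕ} (hks : k ≤ 2 * s) {t : Fin n → Fin k}
    (ht : IsConflictFree k s t) :
    ∃ L : (Fin (s * (n - 1) + k) → ℝ) →ₗ[ℝ] ℝ,
      ∀ g : Fin n → Fin k, g ≠ t → L (selectionSum s g) < L (selectionSum s t) := by
  obtain ⟨c, hc⟩ := exists_weight (n := n) hks
    (fun i => if h : i < n then s * i + t ⟨i, h⟩ else 0)
    (by intro i hi; simp [hi])
    (by
      intro i hi h1 h2
      have hi' : i < n := by omega
      have := ht i hi
      simp only [hi, hi', dif_pos, IsConflict, Nat.mul_add, mul_one] at *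
      omega)
  have hsum : ∀ g : Fin n → Fin k,
      (∑ j : Fin (s * (n - 1) + k), c j • LinearMap.proj (R := ℝ) (φ := fun _ => ℝ) j :
        (Fin (s * (n - 1) + k) → ℝ) →ₗ[ℝ] ℝ) (selectionSum s g) =
        ∑ i, c (windowElem s i (g i)) := by
    intro g
    rw [selectionSum, map_sum]
    refine Finset.sum_congr rfl fun i _ => ?_
    simp [LinearMap.sum_apply, Pi.single_apply]
  refine ⟨∑ j : Fin (s * (n - 1) + k), c j • LinearMap.proj j, fun g hg => ?_⟩
  rw [hsum, hsum]
  have key : ∀ i, g i ≠ t i → c (windowElem s i (g i)) < c (windowElem s i (t i)) := by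
    intro i hi
    have hne : (g i : ℕ) ≠ t i := fun h => hi (Fin.ext h)
    have := hc i i.2 (s * i + g i) (by omega) (by omega) (by simpa using hne)
    simpa [windowElem] using this
  obtain ⟨i, hi⟩ := Function.ne_iff.mp hg
  refine Finset.sum_lt_sum (fun i _ => ?_) ⟨i, Finset.mem_univ _, key i hi⟩
  by_cases h : g i = t i
  · rw [h]
  · exact (key i h).le

theorem isConflictFree_of_mem_extremePoints {n k s : ℕ} {t : Fin n → Fin k}
    (ht : selectionSum s t ∈ Set.extremePoints ℝ
      (convexHull ℝ (Set.range (selectionSum s : (Fin n → Fin k) → _)))) :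
    IsConflictFree k s t := by
  rintro i hi ⟨h1, h2, h3⟩
  set p : Fin n := ⟨i, by omega⟩ with hp
  set q : Fin n := ⟨i + 1, hi⟩ with hq
  have hpq : p ≠ q := by simp [hp, hq]
  set a := windowElem s p (t p) with ha
  set b := windowElem s q (t q) with hb
  have hab : a ≠ b := by
    intro h
    have := congrArg Fin.val h
    simp only [ha, hb, windowElem, hp, hq, Nat.mul_add, mul_one] at this h3
    omega
  have hupd : ∀ (r : Fin n) (u : Fin k), selectionSum s (Function.update t r u) =
      selectionSum s t + (Pi.single (windowElem s r u) 1 -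
        Pi.single (windowElem s r (t r)) 1) := by
    intro r u
    rw [← sub_eq_iff_eq_add', selectionSum, selectionSum, ← Finset.sum_sub_distrib,
      Finset.sum_eq_single r]
    · simp
    · intro i _ hi
      simp [Function.update_of_ne hi]
    · simp
  have hy : selectionSum s t + (Pi.single a 1 - Pi.single b 1) ∈
      convexHull ℝ (Set.range (selectionSum s : (Fin n → Fin k) → _)) := by
    refine subset_convexHull ℝ _
      ⟨Function.update t q ⟨t p - s, by have := (t p).2; omega⟩, ?_⟩
    rw [hupd]
    congr 3
    ext
    simp only [ha, windowElem, hp, hq, Nat.mul_add, mul_one] at h1 ⊢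
    omega
  have hz : selectionSum s t + (Pi.single b 1 - Pi.single a 1) ∈
      convexHull ℝ (Set.range (selectionSum s : (Fin n → Fin k) → _)) := by
    refine subset_convexHull ℝ _ ⟨Function.update t p ⟨t q + s, h2⟩, ?_⟩
    rw [hupd]
    congr 3
    ext
    simp only [hb, windowElem, hp, hq, Nat.mul_add, mul_one]
    omega
  have hmid := ht.2 hy hz ⟨1 / 2, 1 / 2, by norm_num, by norm_num, by norm_num, by module⟩
  have := congrFun (add_eq_left.mp hmid) a
  simp [hab] at this

theorem numVertices_eq_card (n k s : ℕ) (hks : k ≤ 2 * s) :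
    numVertices n k s = Nat.card {t : Fin n → Fin k // IsConflictFree k s t} := by
  have himage : Set.extremePoints ℝ (poolPolytope n k s) =
      selectionSum s '' {t : Fin n → Fin k | IsConflictFree k s t} := by
    rw [poolPolytope_eq_convexHull]
    ext x
    constructor
    · intro hx
      obtain ⟨t, rfl⟩ := extremePoints_convexHull_subset hx
      exact ⟨t, isConflictFree_of_mem_extremePoints hx, rfl⟩
    · rintro ⟨t, ht, rfl⟩
      obtain ⟨L, hL⟩ := exists_linearMap_lt hks ht
      refine mem_extremePoints_convexHull_of_forall_lt ⟨t, rfl⟩ L ?_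
      rintro _ ⟨g, rfl⟩ hg
      exact hL g fun h => hg (h ▸ rfl)
  rw [numVertices, himage, Nat.card_image_of_injOn]
  · rfl
  · intro t ht g _ h
    by_contra hne
    obtain ⟨L, hL⟩ := exists_linearMap_lt hks ht
    exact (hL g (Ne.symm hne)).ne (by rw [h])

theorem isConflictFree_cons {k s n : ℕ} (a : Fin k) (t : Fin (n + 1) → Fin k) :
    IsConflictFree k s (Fin.cons a t : Fin (n + 2) → Fin k) ↔
      ¬ IsConflict k s a (t 0) ∧ IsConflictFree k s t := by
  constructor
  · intro h
    have h0 := h 0 (by omega)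
    exact ⟨h0, fun i hi => h (i + 1) (by omega)⟩
  · rintro ⟨h0, h⟩ i hi
    cases i with
    | zero => exact h0
    | succ i => exact h i (by omega)

theorem isConflictFree_cons_of_isConflict {k s n : ℕ} (hks : k ≤ 2 * s) {a b : Fin k}
    (hab : IsConflict k s a b) (t : Fin n → Fin k) :
    IsConflictFree k s (Fin.cons b t : Fin (n + 1) → Fin k) ↔ IsConflictFree k s t := by
  cases n with
  | zero => exact ⟨fun _ i hi => by omega, fun _ i hi => by omega⟩
  | succ n =>
    rw [isConflictFree_cons]
    refine and_iff_right fun h => ?_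
    have := hab.2.1
    have := h.1
    omega

theorem card_isConflict (k s : ℕ) :
    Nat.card {p : Fin k × Fin k // IsConflict k s p.1 p.2} = (k - s) * (k - s - 1) := by
  have e : {p : Fin k × Fin k // IsConflict k s p.1 p.2} ≃
      ((Finset.univ : Finset (Fin (k - s))).offDiag : Set (Fin (k - s) × Fin (k - s))) :=
    { toFun := fun p => ⟨(⟨p.1.1 - s, by have := p.2.1; omega⟩,
          ⟨p.1.2, by have := p.2.2.1; omega⟩), by
        have := p.2.1
        have := p.2.2.2
        simp only [Finset.coe_offDiag, Set.mem_offDiag, Finset.coe_univ, Set.mem_univ, true_and,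
          ne_eq, Fin.mk.injEq]
        omega⟩
      invFun := fun p => ⟨(⟨p.1.1 + s, by omega⟩, ⟨p.1.2, by omega⟩), by
        have := p.2
        simp only [Finset.coe_offDiag, Set.mem_offDiag, Finset.coe_univ, Set.mem_univ, true_and,
          ne_eq, Fin.ext_iff] at this
        refine ⟨?_, ?_, ?_⟩ <;> (simp only []; omega)⟩
      left_inv := fun p => by
        have := p.2.1
        ext <;> simp only [] <;> omega
      right_inv := fun p => by ext <;> simp }
  rw [Nat.card_congr e, Nat.card_coe_set_eq, Set.ncard_coe_finset, Finset.offDiag_card,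
    Finset.card_univ, Fintype.card_fin, Nat.mul_sub_one]

theorem card_isConflictFree_zero (k s : ℕ) :
    Nat.card {t : Fin 0 → Fin k // IsConflictFree k s t} = 1 := by
  have : ∀ t : Fin 0 → Fin k, IsConflictFree k s t := fun t i hi => by omega
  rw [Nat.card_congr (Equiv.subtypeUnivEquiv this)]
  simp

theorem card_isConflictFree_one (k s : ℕ) :
    Nat.card {t : Fin 1 → Fin k // IsConflictFree k s t} = k := by
  have : ∀ t : Fin 1 → Fin k, IsConflictFree k s t := fun t i hi => by omega
  rw [Nat.card_congr (Equiv.subtypeUnivEquiv this)]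
  simp

theorem card_isConflictFree_add_two {k s : ℕ} (hks : k ≤ 2 * s) (n : ℕ) :
    Nat.card {t : Fin (n + 2) → Fin k // IsConflictFree k s t} +
        (k - s) * (k - s - 1) * Nat.card {t : Fin n → Fin k // IsConflictFree k s t} =
      k * Nat.card {t : Fin (n + 1) → Fin k // IsConflictFree k s t} := by
  classical
  let X := Fin k × {t : Fin (n + 1) → Fin k // IsConflictFree k s t}
  let P : X → Prop := fun x => IsConflict k s x.1 (x.2.1 0)
  have e1 : {t : Fin (n + 2) → Fin k // IsConflictFree k s t} ≃ {x : X // ¬ P x} :=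
    { toFun := fun t =>
        have h := (isConflictFree_cons (t.1 0) (Fin.tail t.1)).1
          (by rw [Fin.cons_self_tail]; exact t.2)
        ⟨(t.1 0, ⟨Fin.tail t.1, h.2⟩), h.1⟩
      invFun := fun x => ⟨Fin.cons x.1.1 x.1.2.1, (isConflictFree_cons _ _).2 ⟨x.2, x.1.2.2⟩⟩
      left_inv := fun t => Subtype.ext (Fin.cons_self_tail _)
      right_inv := fun x => rfl }
  have e2 : {p : Fin k × Fin k // IsConflict k s p.1 p.2} ×
      {t : Fin n → Fin k // IsConflictFree k s t} ≃ {x : X // P x} :=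
    { toFun := fun y => ⟨(y.1.1.1, ⟨Fin.cons y.1.1.2 y.2.1,
          (isConflictFree_cons_of_isConflict hks y.1.2 _).2 y.2.2⟩), y.1.2⟩
      invFun := fun x => (⟨(x.1.1, x.1.2.1 0), x.2⟩, ⟨Fin.tail x.1.2.1,
          (isConflictFree_cons_of_isConflict hks x.2 _).1
            (by rw [Fin.cons_self_tail]; exact x.1.2.2)⟩)
      left_inv := fun y => rfl
      right_inv := fun x => Subtype.ext (Prod.ext rfl (Subtype.ext (Fin.cons_self_tail _))) }
  rw [← card_isConflict, ← Nat.card_prod, Nat.card_congr e1, Nat.card_congr e2, add_comm,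
    ← Nat.card_sum, Nat.card_congr (Equiv.sumCompl P), Nat.card_prod, Nat.card_fin]

/-- large strides `⌈k/2⌉ ≤ s ≤ k−2`: closed formula for `b_n^{(k,s)}` in terms of
`w_± = k ± √(k² − 4(k−s)(k−s−1))`. -/
theorem numVertices_closed_form_large_strides (k s : ℕ) (hk : 0 < k) (hs : 0 < s)
    (h1 : k ≤ 2 * s) (h2 : s ≤ k - 2) (n : ℕ) (hn : 1 ≤ n)
    (wp wm : ℝ)
    (hwp : wp = (k : ℝ) + Real.sqrt ((k : ℝ) ^ 2 - 4 * ((k : ℝ) - s) * ((k : ℝ) - s - 1)))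
    (hwm : wm = (k : ℝ) - Real.sqrt ((k : ℝ) ^ 2 - 4 * ((k : ℝ) - s) * ((k : ℝ) - s - 1))) :
    (numVertices n k s : ℝ) =
      (1 / 2 ^ (n + 1)) *
        (wm ^ n + wp ^ n + (2 * (k : ℝ) / (wp - wm)) * (wp ^ n - wm ^ n)) := by
  have hk2 : s + 2 ≤ k := by omega
  have hk2' : (s : ℝ) + 2 ≤ k := by exact_mod_cast hk2
  have h1' : (k : ℝ) ≤ 2 * s := by exact_mod_cast h1
  have hD : 0 < (k : ℝ) ^ 2 - 4 * ((k : ℝ) - s) * ((k : ℝ) - s - 1) := by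
    nlinarith
  have hpos := Real.sqrt_pos.2 hD
  have hsq := Real.sq_sqrt hD.le
  set D := Real.sqrt ((k : ℝ) ^ 2 - 4 * ((k : ℝ) - s) * ((k : ℝ) - s - 1))
  have hne : wp - wm ≠ 0 := by rw [hwp, hwm]; linarith
  have hp : wp ^ 2 = 2 * k * wp - 4 * (((k : ℝ) - s) * ((k : ℝ) - s - 1)) := by
    rw [hwp]; linear_combination hsq
  have hm : wm ^ 2 = 2 * k * wm - 4 * (((k : ℝ) - s) * ((k : ℝ) - s - 1)) := by
    rw [hwm]; linear_combination hsq
  have hsum : wp + wm = 2 * k := by rw [hwp, hwm]; ring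
  rw [numVertices_eq_card n k s h1]
  clear hn
  induction n using Nat.twoStepInduction with
  | zero => simp [card_isConflictFree_zero]; norm_num
  | one =>
    rw [card_isConflictFree_one]
    field_simp
    linear_combination -hsum
  | more n ih0 ih1 =>
    have hrec := congrArg (Nat.cast (R := ℝ)) (card_isConflictFree_add_two h1 n)
    rw [Nat.cast_add, Nat.cast_mul, Nat.cast_mul, Nat.cast_mul,
      Nat.cast_sub (by omega : 1 ≤ k - s), Nat.cast_sub (by omega : s ≤ k), Nat.cast_one, ih0, ih1] at hrec
    rw [eq_sub_of_add_eq hrec]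
    generalize 2 * (k : ℝ) / (wp - wm) = r
    have e1 : wp ^ (n + 2) = wp ^ n * wp ^ 2 := pow_add _ _ _
    have e2 : wm ^ (n + 2) = wm ^ n * wm ^ 2 := pow_add _ _ _
    rw [e1, e2, hp, hm]
    field_simp
    ring
end

section
/- Let B be the 6×6 integer matrix with rows (2,2,1,1,1,1), (2,3,1,1,2,1), (2,2,1,2,1,1), (2,3,1,2,2,1), (2,4,1,2,4,1), (2,2,1,0,1,1). Then for every integer n ≥ 2, the number of vertices V_n of the polytope Q_n equals the entry in row 5 and column 6 of the matrix power B^n. -/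
open Pointwise

/-- The polytope `Q_n ⊆ ℝ^{3×n}`: the Minkowski sum of the `2(n−1)` simplices
`Δ_{i,j} = conv{e_{i,j}, e_{i,j+1}, e_{i+1,j}, e_{i+1,j+1}}` for `0 ≤ i ≤ 1`, `0 ≤ j ≤ n−2`. -/
noncomputable def Qpolytope (n : ℕ) : Set (Fin 3 × Fin n → ℝ) :=
  ∑ i : Fin 2, ∑ j : Fin (n - 1),
    convexHull ℝ
      ({Pi.single (Fin.castSucc i, ⟨j.1, by have := j.isLt; omega⟩) (1 : ℝ),
        Pi.single (Fin.castSucc i, ⟨j.1 + 1, by have := j.isLt; omega⟩) (1 : ℝ),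
        Pi.single (Fin.succ i, ⟨j.1, by have := j.isLt; omega⟩) (1 : ℝ),
        Pi.single (Fin.succ i, ⟨j.1 + 1, by have := j.isLt; omega⟩) (1 : ℝ)} :
        Set (Fin 3 × Fin n → ℝ))

/-- `V_n`, the number of vertices (extreme points) of `Q_n`. -/
noncomputable def numVerticesQ (n : ℕ) : ℕ :=
  Nat.card (Set.extremePoints ℝ (Qpolytope n))

section Hypergraphic

variable {V : Type*} [DecidableEq V]

/-- The simplex spanned by the standard basis vectors indexed by `S`. -/
def coordSimplex (S : Set V) : Set (V → ℝ) :=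
  convexHull ℝ ((fun v => Pi.single v (1 : ℝ)) '' S)

theorem single_mem_coordSimplex {S : Set V} {v : V} (hv : v ∈ S) :
    Pi.single v (1 : ℝ) ∈ coordSimplex S :=
  subset_convexHull ℝ _ ⟨v, hv, rfl⟩

variable {ι : Type*} [Fintype ι] [Fintype V]

theorem coordSimplex_subset (S : Set V) :
    coordSimplex S ⊆ {y | (∀ v, 0 ≤ y v) ∧ ∑ v, y v = 1 ∧ ∀ v ∉ S, y v = 0} := by
  refine convexHull_min ?_ ?_
  · rintro _ ⟨v, hv, rfl⟩
    refine ⟨fun u => ?_, by simp, fun u hu => ?_⟩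
    · by_cases h : u = v
      · subst h; simp
      · simp [h]
    · have h : u ≠ v := fun h => hu (h ▸ hv)
      simp [h]
  · rintro x ⟨hx0, hx1, hxS⟩ y ⟨hy0, hy1, hyS⟩ a b ha hb hab
    refine ⟨fun v => ?_, ?_, fun v hv => ?_⟩
    · have := hx0 v
      have := hy0 v
      simp only [Pi.add_apply, Pi.smul_apply, smul_eq_mul]
      positivity
    · simp [Finset.sum_add_distrib, ← Finset.mul_sum, hx1, hy1, hab]
    · simp [hxS v hv, hyS v hv]

theorem le_one_of_mem_coordSimplex {S : Set V} {y : V → ℝ} (hy : y ∈ coordSimplex S) (v : V) :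
    y v ≤ 1 := by
  obtain ⟨h0, h1, -⟩ := coordSimplex_subset S hy
  exact h1 ▸ Finset.single_le_sum (fun u _ => h0 u) (Finset.mem_univ v)

/-- A weight on `S` with a unique maximizer `v` is uniquely maximized at the vertex `v` of the
simplex. -/
theorem coordSimplex_unique_max {S : Set V} {v : V} {w : V → ℝ}
    (hw : ∀ u ∈ S, u ≠ v → w u < w v) {y : V → ℝ} (hy : y ∈ coordSimplex S) :
    ∑ u, w u * y u ≤ w v ∧ (w v ≤ ∑ u, w u * y u → y = Pi.single v 1) := by
  obtain ⟨h0, h1, hS⟩ := coordSimplex_subset S hy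
  have key : w v - ∑ u, w u * y u = ∑ u, (w v - w u) * y u := by
    simp [sub_mul, ← Finset.mul_sum, h1]
  have hnn : ∀ u ∈ Finset.univ, 0 ≤ (w v - w u) * y u := by
    intro u _
    by_cases huS : u ∈ S
    · by_cases huv : u = v
      · simp [huv]
      · exact mul_nonneg (sub_nonneg.2 (hw u huS huv).le) (h0 u)
    · simp [hS u huS]
  refine ⟨by linarith [Finset.sum_nonneg hnn], fun hle => ?_⟩
  have hz := (Finset.sum_eq_zero_iff_of_nonneg hnn).1
    (le_antisymm (by linarith) (Finset.sum_nonneg hnn))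
  have hoff : ∀ u, u ≠ v → y u = 0 := by
    intro u huv
    by_cases huS : u ∈ S
    · exact (mul_eq_zero.1 (hz u (Finset.mem_univ u))).resolve_left
        (sub_ne_zero.2 (hw u huS huv).ne')
    · exact hS u huS
  ext u
  by_cases huv : u = v
  · subst huv
    rw [Finset.sum_eq_single u (fun b _ hb => hoff b hb) (by simp)] at h1
    simp [h1]
  · simp [huv, hoff u huv]

/-- The choices of one head per hyperedge which induce an acyclic orientation, where acyclicity
is witnessed by a potential on the vertex set. -/
def acyclicHeads (S : ι → Set V) : Set (ι → V) :=
  {f | (∀ i, f i ∈ S i) ∧ ∃ w : V → ℝ, ∀ i, ∀ v ∈ S i, v ≠ f i → w v < w (f i)}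

theorem eq_of_sum_weight_le {S : ι → Set V} {f : ι → V} {w : V → ℝ}
    (hw : ∀ i, ∀ v ∈ S i, v ≠ f i → w v < w (f i)) {y : ι → V → ℝ}
    (hy : ∀ i, y i ∈ coordSimplex (S i)) :
    ∑ u, w u * (∑ i, y i) u ≤ ∑ i, w (f i) ∧
      (∑ i, w (f i) ≤ ∑ u, w u * (∑ i, y i) u → y = fun i => Pi.single (f i) 1) := by
  have hcomm : ∑ u, w u * (∑ i, y i) u = ∑ i, ∑ u, w u * y i u := by
    simp only [Finset.sum_apply, Finset.mul_sum]
    exact Finset.sum_comm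
  have hle : ∀ i ∈ Finset.univ, ∑ u, w u * y i u ≤ w (f i) :=
    fun i _ => (coordSimplex_unique_max (hw i) (hy i)).1
  rw [hcomm]
  refine ⟨Finset.sum_le_sum hle, fun h => ?_⟩
  have heq := (Finset.sum_eq_sum_iff_of_le hle).1 (le_antisymm (Finset.sum_le_sum hle) h)
  funext i
  exact (coordSimplex_unique_max (hw i) (hy i)).2 (heq i (Finset.mem_univ i)).ge

theorem sum_weight_single (f : ι → V) (w : V → ℝ) :
    ∑ u, w u * (∑ i, Pi.single (f i) (1 : ℝ) : V → ℝ) u = ∑ i, w (f i) := by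
  simp only [Finset.sum_apply, Finset.mul_sum]
  rw [Finset.sum_comm]
  simp [Pi.single_apply]

theorem injOn_sum_single (S : ι → Set V) :
    Set.InjOn (fun f : ι → V => (∑ i, Pi.single (f i) (1 : ℝ) : V → ℝ)) (acyclicHeads S) := by
  rintro f ⟨-, w, hw⟩ g ⟨hg, -⟩ hfg
  have h := (eq_of_sum_weight_le hw (y := fun i => Pi.single (g i) 1)
    fun i => single_mem_coordSimplex (hg i)).2
  simp only at hfg
  rw [← hfg, sum_weight_single] at h
  funext i
  have h' := congrFun (congrFun (h le_rfl) i) (g i)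
  by_contra hne
  simp [Ne.symm hne] at h'

theorem sum_single_mem_extremePoints {S : ι → Set V} {f : ι → V} (hf : f ∈ acyclicHeads S) :
    (∑ i, Pi.single (f i) (1 : ℝ) : V → ℝ) ∈
      Set.extremePoints ℝ (∑ i, coordSimplex (S i)) := by
  obtain ⟨hfS, w, hw⟩ := hf
  apply exposedPoints_subset_extremePoints
  have hL : ∀ y : V → ℝ, (∑ u, w u • ContinuousLinearMap.proj (R := ℝ) (φ := fun _ : V => ℝ) u) y
      = ∑ u, w u * y u := fun y => by simp
  refine ⟨Set.mem_fintype_sum _ _ |>.2 ⟨_, fun i => single_mem_coordSimplex (hfS i), rfl⟩,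
    ∑ u, w u • ContinuousLinearMap.proj u, fun y hy => ?_⟩
  obtain ⟨z, hz, rfl⟩ := (Set.mem_fintype_sum _ _).1 hy
  rw [hL, hL, sum_weight_single]
  have h := eq_of_sum_weight_le hw hz
  exact ⟨h.1, fun hle => by rw [h.2 hle]⟩

theorem sum_update_mem {E : Type*} [AddCommGroup E] [DecidableEq ι] {D : ι → Set E} {y : ι → E}
    (hy : ∀ i, y i ∈ D i) {j : ι} {p : E} (hp : p ∈ D j) :
    ∑ i, y i - y j + p ∈ ∑ i, D i := by
  refine (Set.mem_fintype_sum _ _).2 ⟨Function.update y j p, fun i => ?_, ?_⟩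
  · by_cases h : i = j
    · subst h; simpa
    · simpa [h] using hy i
  · rw [Finset.sum_update_of_mem (Finset.mem_univ j), ← Finset.sum_sdiff (Finset.subset_univ {j})]
    simp only [Finset.sum_singleton]
    abel

/-- An extreme point of a Minkowski sum decomposes uniquely. -/
theorem decomposition_unique_of_extreme {E : Type*} [AddCommGroup E] [Module ℝ E]
    {D : ι → Set E} {x y : ι → E} (hx : ∀ i, x i ∈ D i) (hy : ∀ i, y i ∈ D i)
    (hext : ∑ i, x i ∈ Set.extremePoints ℝ (∑ i, D i)) (hxy : ∑ i, y i = ∑ i, x i) : y = x := by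
  classical
  funext j
  have h1 := sum_update_mem hx (hy j)
  have h2 := sum_update_mem hy (hx j)
  have h := hext.2 h1 h2 ⟨1 / 2, 1 / 2, by norm_num, by norm_num, by norm_num, by
    rw [hxy]; module⟩
  have h3 : y j - x j = 0 := by
    rw [← sub_eq_zero] at h
    rw [← h]; abel
  exact sub_eq_zero.1 h3

theorem summand_extreme_of_extreme {E : Type*} [AddCommGroup E] [Module ℝ E]
    {D : ι → Set E} {x : ι → E} (hx : ∀ i, x i ∈ D i)
    (hext : ∑ i, x i ∈ Set.extremePoints ℝ (∑ i, D i)) (j : ι) :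
    x j ∈ Set.extremePoints ℝ (D j) := by
  classical
  refine ⟨hx j, fun p hp q hq hpq => ?_⟩
  obtain ⟨a, b, ha, hb, hab, h⟩ := hpq
  have h' := hext.2 (sum_update_mem hx hp) (sum_update_mem hx hq) ⟨a, b, ha, hb, hab, by
    obtain rfl : b = 1 - a := by linarith
    rw [← h]; module⟩
  have h3 : p - x j = 0 := by
    rw [← sub_eq_zero] at h'
    rw [← h']; abel
  exact sub_eq_zero.1 h3

/-- Along a directed path from `a` to `b`, mass can be moved inside the simplices. -/
theorem exists_shift_of_transGen {S : ι → Set V} {f : ι → V} (hf : ∀ i, f i ∈ S i) {a b : V}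
    (h : Relation.TransGen (fun a b => ∃ i, f i = a ∧ b ∈ S i ∧ b ≠ a) a b) :
    ∃ ε : ℝ, 0 < ε ∧ ∃ y : ι → V → ℝ, (∀ i, y i ∈ coordSimplex (S i)) ∧
      ∑ i, y i = (∑ i, Pi.single (f i) (1 : ℝ) : V → ℝ) + ε • (Pi.single b 1 - Pi.single a 1) ∧
      ∃ i, y i (f i) < 1 := by
  classical
  have step : ∀ a b, (∃ i, f i = a ∧ b ∈ S i ∧ b ≠ a) →
      ∃ ε : ℝ, 0 < ε ∧ ∃ y : ι → V → ℝ, (∀ i, y i ∈ coordSimplex (S i)) ∧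
      ∑ i, y i = (∑ i, Pi.single (f i) (1 : ℝ) : V → ℝ) + ε • (Pi.single b 1 - Pi.single a 1) ∧
      ∃ i, y i (f i) < 1 := by
    rintro _ b ⟨j, rfl, hb, hne⟩
    refine ⟨1, one_pos, Function.update (fun i => Pi.single (f i) 1) j (Pi.single b 1),
      fun i => ?_, ?_, j, ?_⟩
    · by_cases h : i = j
      · subst h; simpa using single_mem_coordSimplex hb
      · simpa [h] using single_mem_coordSimplex (hf i)
    · rw [Finset.sum_update_of_mem (Finset.mem_univ j),
        ← Finset.sum_sdiff (Finset.subset_univ {j})]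
      simp only [Finset.sum_singleton, one_smul]
      abel
    · simp [hne.symm]
  induction h with
  | single h => exact step _ _ h
  | @tail b c _ h ih =>
    obtain ⟨ε, hε, y, hy, hsum, i, hi⟩ := ih
    obtain ⟨δ, hδ, z, hz, hsum', -⟩ := step _ _ h
    have hpos : 0 < ε + δ := by positivity
    refine ⟨δ / (ε + δ) * ε, by positivity,
      fun i => (δ / (ε + δ)) • y i + (ε / (ε + δ)) • z i, fun i => ?_, ?_, i, ?_⟩
    · exact convex_convexHull ℝ _ (hy i) (hz i) (by positivity) (by positivity) (by
        rw [← add_div, add_comm δ, div_self hpos.ne'])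
    · rw [Finset.sum_add_distrib, ← Finset.smul_sum, ← Finset.smul_sum, hsum, hsum']
      have h1 : δ / (ε + δ) = 1 - ε / (ε + δ) := by field_simp; ring
      have h2 : ε / (ε + δ) * δ = δ / (ε + δ) * ε := by ring
      rw [smul_add, smul_add, smul_smul, smul_smul, h2, h1]
      module
    · have h1 : z i (f i) ≤ 1 := le_one_of_mem_coordSimplex (hz i) _
      have hpos1 : 0 < δ / (ε + δ) := by positivity
      have hpos2 : 0 < ε / (ε + δ) := by positivity
      have h2 : δ / (ε + δ) + ε / (ε + δ) = 1 := by
        rw [← add_div, add_comm δ, div_self hpos.ne']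
      simp only [Pi.add_apply, Pi.smul_apply, smul_eq_mul]
      nlinarith [mul_lt_mul_of_pos_left hi hpos1, mul_le_mul_of_nonneg_left h1 hpos2.le]

/-- A finite acyclic relation has a strictly decreasing potential. -/
theorem exists_potential {U : Type*} [Fintype U] {r : U → U → Prop}
    (h : ∀ a, ¬ Relation.TransGen r a a) :
    ∃ w : U → ℝ, ∀ a b, r a b → w b < w a := by
  classical
  refine ⟨fun a => ((Finset.univ.filter fun b => Relation.TransGen r a b).card : ℝ),
    fun a b hab => ?_⟩
  rw [Nat.cast_lt]
  refine Finset.card_lt_card ⟨fun c hc => ?_, fun hsub => ?_⟩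
  · simp only [Finset.mem_filter, Finset.mem_univ, true_and] at hc ⊢
    exact Relation.TransGen.head hab hc
  · have : b ∈ Finset.univ.filter fun c => Relation.TransGen r b c :=
      hsub (by simpa using Relation.TransGen.single hab)
    exact h b (by simpa using this)

/-- The vertices of a Minkowski sum of coordinate simplices correspond to the acyclic
orientations of the underlying hypergraph. -/
theorem extremePoints_sum_coordSimplex (S : ι → Set V) :
    Set.extremePoints ℝ (∑ i, coordSimplex (S i)) =
      (fun f : ι → V => (∑ i, Pi.single (f i) (1 : ℝ) : V → ℝ)) '' acyclicHeads S := by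
  refine Set.Subset.antisymm (fun x hx => ?_) ?_
  · obtain ⟨y, hy, rfl⟩ := (Set.mem_fintype_sum _ _).1 hx.1
    have hv : ∀ i, ∃ v, v ∈ S i ∧ (Pi.single v (1 : ℝ) : V → ℝ) = y i := fun i => by
      have h := extremePoints_convexHull_subset (summand_extreme_of_extreme hy hx i)
      exact h
    choose f hf hfy using hv
    obtain rfl : (fun i => Pi.single (f i) (1 : ℝ)) = y := funext hfy
    refine ⟨f, ⟨hf, ?_⟩, rfl⟩
    obtain ⟨w, hw⟩ := exists_potential
      (r := fun a b => ∃ i, f i = a ∧ b ∈ S i ∧ b ≠ a) (fun a ha => by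
        obtain ⟨ε, -, z, hz, hsum, i, hi⟩ := exists_shift_of_transGen hf ha
        have := decomposition_unique_of_extreme hy hz hx (by simpa using hsum)
        simp [this] at hi)
    exact ⟨w, fun i v hv hne => hw _ _ ⟨i, rfl, hv, hne⟩⟩
  · rintro _ ⟨f, hf, rfl⟩
    exact sum_single_mem_extremePoints hf

theorem card_extremePoints_sum_coordSimplex (S : ι → Set V) :
    Nat.card (Set.extremePoints ℝ (∑ i, coordSimplex (S i))) = Nat.card (acyclicHeads S) := by
  rw [extremePoints_sum_coordSimplex]
  exact Nat.card_image_of_injOn (injOn_sum_single S)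

end Hypergraphic

section Elimination

variable {α : Type*}

/-- `u` satisfies all strict inequalities `u b < u a` for `(a, b)` in the list `E`. -/
def Sat (u : α → ℝ) (E : List (α × α)) : Prop :=
  ∀ p ∈ E, u p.2 < u p.1

variable [DecidableEq α]

/-- Fourier–Motzkin elimination of the variable `x`. -/
def elim (x : α) (E : List (α × α)) : List (α × α) :=
  (E.filter fun p => p.1 ≠ x ∧ p.2 ≠ x) ++
    (E.filter fun p => p.2 = x).flatMap fun p =>
      (E.filter fun q => q.1 = x).map fun q => (p.1, q.2)

theorem mem_elim {x : α} {E : List (α × α)} {a b : α} :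
    (a, b) ∈ elim x E ↔ ((a, b) ∈ E ∧ a ≠ x ∧ b ≠ x) ∨ ((a, x) ∈ E ∧ (x, b) ∈ E) := by
  simp only [elim, List.mem_append, List.mem_filter, List.mem_flatMap, List.mem_map,
    decide_eq_true_eq, Prod.exists, Prod.mk.injEq]
  refine or_congr Iff.rfl ⟨?_, ?_⟩
  · rintro ⟨c, _, ⟨h1, rfl⟩, _, d, ⟨h2, rfl⟩, rfl, rfl⟩
    exact ⟨h1, h2⟩
  · rintro ⟨h1, h2⟩
    exact ⟨a, x, ⟨h1, rfl⟩, x, b, ⟨h2, rfl⟩, rfl, rfl⟩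

theorem sat_elim_iff {x : α} {E : List (α × α)} {u : α → ℝ} :
    Sat u (elim x E) ↔ ∃ t, Sat (Function.update u x t) E := by
  constructor
  · intro h
    have hloop : (x, x) ∉ E := fun hx =>
      lt_irrefl _ (h (x, x) (mem_elim.2 (Or.inr ⟨hx, hx⟩)))
    obtain ⟨t, hlo, hhi⟩ := Order.exists_between_finsets
      ((E.filter fun q => q.1 = x).map fun q => u q.2).toFinset
      ((E.filter fun p => p.2 = x).map fun p => u p.1).toFinset (by
        simp only [List.mem_toFinset, List.mem_map, List.mem_filter, decide_eq_true_eq,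
          Prod.exists]
        rintro _ ⟨_, b, ⟨h1, rfl⟩, rfl⟩ _ ⟨a, _, ⟨h2, rfl⟩, rfl⟩
        exact h (a, b) (mem_elim.2 (Or.inr ⟨h2, h1⟩)))
    simp only [List.mem_toFinset, List.mem_map, List.mem_filter, decide_eq_true_eq,
      Prod.exists] at hlo hhi
    refine ⟨t, ?_⟩
    rintro ⟨a, b⟩ hab
    by_cases ha : a = x
    · subst ha
      have hb : b ≠ a := by rintro rfl; exact hloop hab
      simpa [hb] using hlo _ ⟨a, b, ⟨hab, rfl⟩, rfl⟩
    · by_cases hb : b = x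
      · subst hb
        simpa [ha] using hhi _ ⟨a, b, ⟨hab, rfl⟩, rfl⟩
      · simpa [ha, hb] using h (a, b) (mem_elim.2 (Or.inl ⟨hab, ha, hb⟩))
  · rintro ⟨t, ht⟩ ⟨a, b⟩ hab
    rcases mem_elim.1 hab with ⟨h, ha, hb⟩ | ⟨h1, h2⟩
    · simpa [ha, hb] using ht (a, b) h
    · have h1' := ht _ h1
      have h2' := ht _ h2
      by_cases ha : a = x
      · subst ha; exact absurd h1' (lt_irrefl _)
      by_cases hb : b = x
      · subst hb; exact absurd h2' (lt_irrefl _)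
      simp [ha, hb] at h1' h2'
      exact h2'.trans h1'

end Elimination

section Transfer

/-- The corners of a square: the row offset and the column offset. -/
abbrev Corner := Fin 2 × Fin 2

/-- A choice of heads for the two squares between two consecutive columns. -/
abbrev Step := Fin 2 → Corner

/-- The row of the `a`-th cell in the `i`-th row of squares. -/
def cornerRow (i a : Fin 2) : Fin 3 := if a = 0 then i.castSucc else i.succ

/-- The cells of two consecutive columns: column offset and row. -/
def corner (i : Fin 2) (k : Corner) : Fin 2 × Fin 3 := (k.2, cornerRow i k.1)

/-- The potentials on two consecutive columns, as one function. -/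
def glue (u v : Fin 3 → ℝ) (p : Fin 2 × Fin 3) : ℝ := if p.1 = 0 then u p.2 else v p.2

/-- The potentials `u`, `v` on two consecutive columns are compatible with the heads `s`. -/
def StepOK (s : Step) (u v : Fin 3 → ℝ) : Prop :=
  ∀ i k, k ≠ s i → glue u v (corner i k) < glue u v (corner i (s i))

def cornerList : List Corner := [(0, 0), (0, 1), (1, 0), (1, 1)]

def stepEdges (s : Step) : List ((Fin 2 × Fin 3) × (Fin 2 × Fin 3)) :=
  [0, 1].flatMap fun i =>
    (cornerList.filter fun k => k ≠ s i).map fun k => (corner i (s i), corner i k)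

def liftEdges (c : Fin 2) (R : List (Fin 3 × Fin 3)) :
    List ((Fin 2 × Fin 3) × (Fin 2 × Fin 3)) :=
  R.map fun p => ((c, p.1), (c, p.2))

/-- The constraints on the new column obtained by eliminating the old column. -/
def eliminated (R : List (Fin 3 × Fin 3)) (s : Step) :
    List ((Fin 2 × Fin 3) × (Fin 2 × Fin 3)) :=
  elim (0, 2) (elim (0, 1) (elim (0, 0) (liftEdges 0 R ++ stepEdges s)))

def colPairs : List (Fin 3 × Fin 3) :=
  [(0, 0), (0, 1), (0, 2), (1, 0), (1, 1), (1, 2), (2, 0), (2, 1), (2, 2)]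

def derivable (L : List ((Fin 2 × Fin 3) × (Fin 2 × Fin 3))) (p : Fin 3 × Fin 3) : Bool :=
  (L.any fun q => q.1 = q.2) || L.contains ((1, p.1), (1, p.2)) ||
    [0, 1, 2].any fun b => L.contains ((1, p.1), (1, b)) && L.contains ((1, b), (1, p.2))

/-- The order constraints on the new column, given those on the old one. -/
def nextRel (R : List (Fin 3 × Fin 3)) (s : Step) : List (Fin 3 × Fin 3) :=
  colPairs.filter (derivable (eliminated R s))

def classes : List (List (Fin 3 × Fin 3) × Fin 6) :=
  [([], 4), ([(1, 2)], 1), ([(2, 1)], 3), ([(2, 0), (2, 1)], 1), ([(0, 1), (0, 2)], 1),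
   ([(0, 1)], 3), ([(0, 1), (0, 2), (1, 2)], 0), ([(0, 1), (2, 1)], 2), ([(1, 0)], 1),
   ([(1, 0), (1, 2)], 5), ([(1, 0), (2, 0), (2, 1)], 0)]

def steps : List Step :=
  cornerList.flatMap fun a => cornerList.map fun b => ![a, b]

theorem mem_steps (s : Step) : s ∈ steps := by
  have hc : ∀ k : Corner, k ∈ cornerList := by decide
  simp only [steps, List.mem_flatMap, List.mem_map]
  exact ⟨s 0, hc _, s 1, hc _, by ext i : 1; fin_cases i <;> rfl⟩

theorem mem_stepEdges {s : Step} {a b : Fin 2 × Fin 3} :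
    (a, b) ∈ stepEdges s ↔ ∃ i k, k ≠ s i ∧ corner i (s i) = a ∧ corner i k = b := by
  have hc : ∀ k : Corner, k ∈ cornerList := by decide
  simp [stepEdges, hc, Fin.exists_fin_two]

theorem stepOK_iff {s : Step} {u v : Fin 3 → ℝ} :
    StepOK s u v ↔ Sat (glue u v) (stepEdges s) := by
  constructor
  · rintro h ⟨a, b⟩ hab
    obtain ⟨i, k, hk, rfl, rfl⟩ := mem_stepEdges.1 hab
    exact h i k hk
  · exact fun h i k hk => h (_, _) (mem_stepEdges.2 ⟨i, k, hk, rfl, rfl⟩)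

theorem sat_append {α : Type*} {u : α → ℝ} {E F : List (α × α)} :
    Sat u (E ++ F) ↔ Sat u E ∧ Sat u F :=
  List.forall_mem_append

theorem sat_liftEdges {u v : Fin 3 → ℝ} {R : List (Fin 3 × Fin 3)} :
    Sat (glue u v) (liftEdges 0 R) ↔ Sat u R :=
  List.forall_mem_map

theorem sat_eliminated {R : List (Fin 3 × Fin 3)} {s : Step} {v : Fin 3 → ℝ} :
    Sat (glue 0 v) (eliminated R s) ↔ ∃ u, Sat u R ∧ StepOK s u v := by
  simp only [eliminated, sat_elim_iff]
  have hglue : ∀ a b c : ℝ, Function.update (Function.update (Function.update (glue 0 v)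
      (0, 2) c) (0, 1) b) (0, 0) a = glue ![a, b, c] v := by
    intro a b c
    funext ⟨i, j⟩
    fin_cases i <;> fin_cases j <;> simp [glue, Function.update, Prod.ext_iff]
  simp only [hglue, sat_append, sat_liftEdges, ← stepOK_iff]
  constructor
  · rintro ⟨c, b, a, h⟩
    exact ⟨_, h⟩
  · rintro ⟨u, h⟩
    refine ⟨u 2, u 1, u 0, ?_⟩
    have : ![u 0, u 1, u 2] = u := by ext i; fin_cases i <;> rfl
    rwa [this]

theorem mem_nextRel {R : List (Fin 3 × Fin 3)} {s : Step} {a b : Fin 3} :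
    (a, b) ∈ nextRel R s ↔ (∃ c, (c, c) ∈ eliminated R s) ∨
      ((1, a), (1, b)) ∈ eliminated R s ∨
      ∃ c, ((1, a), (1, c)) ∈ eliminated R s ∧ ((1, c), (1, b)) ∈ eliminated R s := by
  have hc : ∀ p : Fin 3 × Fin 3, p ∈ colPairs := by decide
  simp only [nextRel, derivable, List.mem_filter, hc, true_and, Bool.or_eq_true, List.any_eq_true,
    List.contains_iff_mem, Bool.and_eq_true, decide_eq_true_eq, or_assoc]
  refine or_congr ?_ (or_congr Iff.rfl ?_)
  · constructor
    · rintro ⟨⟨c, d⟩, h, rfl : c = d⟩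
      exact ⟨c, h⟩
    · rintro ⟨c, h⟩
      exact ⟨_, h, rfl⟩
  · simp [Fin.exists_fin_succ]

theorem eliminated_check : ∀ P ∈ classes, ∀ s ∈ steps,
    (∃ p ∈ eliminated P.1 s, p.1 = p.2) ∨
      ∀ p ∈ eliminated P.1 s, p.1.1 = 1 ∧ p.2.1 = 1 := by
  decide +kernel

theorem sat_nextRel {P : List (Fin 3 × Fin 3) × Fin 6} (hP : P ∈ classes) {s : Step}
    {v : Fin 3 → ℝ} : Sat v (nextRel P.1 s) ↔ ∃ u, Sat u P.1 ∧ StepOK s u v := by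
  rw [← sat_eliminated]
  constructor
  · rintro h ⟨⟨i, a⟩, ⟨j, b⟩⟩ hab
    rcases eliminated_check P hP s (mem_steps s) with ⟨⟨c, d⟩, hc, rfl : c = d⟩ | hcol
    · exact absurd (h (0, 0) (mem_nextRel.2 (Or.inl ⟨c, hc⟩))) (lt_irrefl _)
    · obtain ⟨rfl : i = 1, rfl : j = 1⟩ := hcol _ hab
      simpa [glue] using h (a, b) (mem_nextRel.2 (Or.inr (Or.inl hab)))
  · rintro h ⟨a, b⟩ hab
    rcases mem_nextRel.1 hab with ⟨c, hc⟩ | hc | ⟨c, h1, h2⟩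
    · exact absurd (h _ hc) (lt_irrefl _)
    · simpa [glue] using h _ hc
    · have hac := h _ h1
      have hcb := h _ h2
      simp only [glue, one_ne_zero, if_false] at hac hcb
      exact hcb.trans hac

/-- The head choices on `m` consecutive column steps which are compatible with some potential
whose restriction to the first column satisfies `R`. -/
def feasible (R : List (Fin 3 × Fin 3)) (m : ℕ) : Set (Fin m → Step) :=
  {f | ∃ w : ℕ → Fin 3 → ℝ, Sat (w 0) R ∧ ∀ j : Fin m, StepOK (f j) (w j) (w (j + 1))}

theorem cons_mem_feasible {P : List (Fin 3 × Fin 3) × Fin 6} (hP : P ∈ classes) {m : ℕ}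
    {s : Step} {f : Fin m → Step} :
    (Fin.cons s f : Fin (m + 1) → Step) ∈ feasible P.1 (m + 1) ↔
      f ∈ feasible (nextRel P.1 s) m := by
  constructor
  · rintro ⟨w, h0, h⟩
    refine ⟨fun j => w (j + 1), (sat_nextRel hP).2 ⟨w 0, h0, by simpa using h 0⟩, fun j => ?_⟩
    simpa using h j.succ
  · rintro ⟨w, h0, h⟩
    obtain ⟨u, hu, hs⟩ := (sat_nextRel hP).1 h0
    refine ⟨fun j => Nat.casesOn j u w, hu, fun j => ?_⟩
    refine Fin.cases ?_ (fun j => ?_) j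
    · simpa using hs
    · simpa using h j

theorem card_feasible_succ {P : List (Fin 3 × Fin 3) × Fin 6} (hP : P ∈ classes) (m : ℕ) :
    Nat.card (feasible P.1 (m + 1)) = ∑ s : Step, Nat.card (feasible (nextRel P.1 s) m) := by
  rw [← Nat.card_sigma]
  refine Nat.card_congr ⟨fun f => ⟨f.1 0, Fin.tail f.1, ?_⟩,
    fun g => ⟨Fin.cons g.1 g.2.1, (cons_mem_feasible hP).2 g.2.2⟩, fun f => ?_, fun g => ?_⟩
  · rw [← cons_mem_feasible hP, Fin.cons_self_tail]
    exact f.2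
  · simp
  · rfl

theorem feasible_eq_empty {R : List (Fin 3 × Fin 3)} (hR : (0, 0) ∈ R) (m : ℕ) :
    feasible R m = ∅ :=
  Set.eq_empty_of_forall_notMem fun _ ⟨_, h, _⟩ => lt_irrefl _ (h _ hR)

theorem feasible_zero {P : List (Fin 3 × Fin 3) × Fin 6} (hP : P ∈ classes) :
    Nat.card (feasible P.1 0) = 1 := by
  have hu : ∃ u : Fin 3 → ℕ, ∀ p ∈ P.1, u p.2 < u p.1 := by
    have h : ∀ P ∈ classes, ∃ u : Fin 3 → Fin 3, ∀ p ∈ P.1, u p.2 < u p.1 := by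
      decide +kernel
    obtain ⟨u, hu⟩ := h P hP
    exact ⟨fun i => u i, fun p hp => hu p hp⟩
  obtain ⟨u, hu⟩ := hu
  have : feasible P.1 0 = Set.univ :=
    Set.eq_univ_of_forall fun f => ⟨fun _ i => u i, fun p hp => Nat.cast_lt.2 (hu p hp),
      fun j => j.elim0⟩
  simp [this]

def transferMatrix : Matrix (Fin 6) (Fin 6) ℤ :=
  !![2, 2, 1, 1, 1, 1;
     2, 3, 1, 1, 2, 1;
     2, 2, 1, 2, 1, 1;
     2, 3, 1, 2, 2, 1;
     2, 4, 1, 2, 4, 1;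
     2, 2, 1, 0, 1, 1]

/-- The class of a column relation, if it has no loop. -/
def classOf (R : List (Fin 3 × Fin 3)) : Option (Fin 6) := classes.lookup R

theorem classOf_eq : ∀ P ∈ classes, classOf P.1 = some P.2 := by decide +kernel

theorem classOf_dead_or_mem : ∀ P ∈ classes, ∀ s ∈ steps,
    ((0, 0) ∈ nextRel P.1 s ∧ classOf (nextRel P.1 s) = none) ∨
      ∃ P' ∈ classes, P'.1 = nextRel P.1 s := by
  decide +kernel

theorem card_class_successors : ∀ P ∈ classes, ∀ k : Fin 6,
    (((steps.filter fun s => classOf (nextRel P.1 s) = some k).length : ℕ) : ℤ) =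
      transferMatrix P.2 k := by
  decide +kernel

theorem card_feasible (m : ℕ) : ∀ P ∈ classes,
    (Nat.card (feasible P.1 m) : ℤ) = ((transferMatrix ^ m).mulVec 1) P.2 := by
  induction m with
  | zero =>
    intro P hP
    simp [feasible_zero hP]
  | succ m ih =>
    intro P hP
    set a := (transferMatrix ^ m).mulVec 1 with ha
    have hterm : ∀ s : Step, (Nat.card (feasible (nextRel P.1 s) m) : ℤ) =
        ∑ k, if classOf (nextRel P.1 s) = some k then a k else 0 := by
      intro s
      rcases classOf_dead_or_mem P hP s (mem_steps s) with ⟨h0, hnone⟩ | ⟨P', hP', heq⟩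
      · simp [feasible_eq_empty h0, hnone]
      · rw [← heq, ih P' hP', classOf_eq P' hP']
        simp
    have huniv : (Finset.univ : Finset Step) = steps.toFinset := by
      ext s; simp [mem_steps]
    have hnodup : steps.Nodup := by decide +kernel
    rw [card_feasible_succ hP, Nat.cast_sum, Finset.sum_congr rfl fun s _ => hterm s,
      Finset.sum_comm, pow_succ', ← Matrix.mulVec_mulVec, ← ha, Matrix.mulVec, dotProduct]
    refine Finset.sum_congr rfl fun k _ => ?_
    rw [← Finset.sum_filter, Finset.sum_const, nsmul_eq_mul, ← card_class_successors P hP k, huniv,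
      ← List.toFinset_card_of_nodup (hnodup.filter _), List.toFinset_filter]
    simp only [decide_eq_true_eq]

end Transfer

section Grid

/-- The corner `k` of the square `h` of the `3 × (m + 1)` grid. -/
def cell {m : ℕ} (h : Fin 2 × Fin m) (k : Corner) : Fin 3 × Fin (m + 1) :=
  (cornerRow h.1 k.1, if k.2 = 0 then h.2.castSucc else h.2.succ)

theorem cell_injective {m : ℕ} (h : Fin 2 × Fin m) : Function.Injective (cell h) := by
  have hrow : ∀ i a b : Fin 2, cornerRow i a = cornerRow i b → a = b := by decide
  rintro ⟨a, b⟩ ⟨a', b'⟩ hab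
  simp only [cell, Prod.mk.injEq] at hab
  obtain ⟨h1, h2⟩ := hab
  obtain rfl := hrow _ _ _ h1
  have hb : b = b' := by
    have hcol : h.2.castSucc ≠ h.2.succ := Fin.castSucc_lt_succ.ne
    by_cases hb : b = 0 <;> by_cases hb' : b' = 0
    · rw [hb, hb']
    · exact absurd (by simpa [hb, hb'] using h2) hcol
    · exact absurd (by simpa [hb, hb'] using h2.symm) hcol
    · omega
  rw [hb]

theorem glue_corner {m : ℕ} {w : Fin 3 × Fin (m + 1) → ℝ} {W : ℕ → Fin 3 → ℝ}
    (hW : ∀ (j : Fin (m + 1)) r, W j r = w (r, j)) (i : Fin 2) (j : Fin m) (k : Corner) :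
    glue (W j) (W (j + 1)) (corner i k) = w (cell (i, j) k) := by
  have h1 := hW j.castSucc
  have h2 := hW j.succ
  simp only [Fin.val_castSucc, Fin.val_succ] at h1 h2
  by_cases hk : k.2 = 0 <;> simp [glue, corner, cell, hk, h1, h2]

/-- The heads chosen by a sequence of steps. -/
def heads {m : ℕ} (s : Fin m → Step) (h : Fin 2 × Fin m) : Fin 3 × Fin (m + 1) :=
  cell h (s h.2 h.1)

theorem heads_injective (m : ℕ) : Function.Injective (heads (m := m)) := fun _ _ hst =>
  funext fun j => funext fun i => cell_injective (i, j) (congrFun hst (i, j))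

theorem image_heads_feasible (m : ℕ) :
    heads '' feasible [] m = acyclicHeads fun h : Fin 2 × Fin m => Set.range (cell h) := by
  ext f
  constructor
  · rintro ⟨s, ⟨W, -, hs⟩, rfl⟩
    refine ⟨fun h => ⟨_, rfl⟩, fun p => W p.2 p.1, ?_⟩
    rintro ⟨i, j⟩ _ ⟨k, rfl⟩ hk
    have h := hs j i k fun hk' => hk (by simp [heads, hk'])
    rwa [glue_corner (w := fun p => W p.2 p.1) (fun _ _ => rfl),
      glue_corner (w := fun p => W p.2 p.1) (fun _ _ => rfl)] at h
  · rintro ⟨hf, w, hw⟩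
    choose k hk using hf
    obtain rfl : heads (fun j i => k (i, j)) = f := funext hk
    obtain ⟨W, hW⟩ : ∃ W : ℕ → Fin 3 → ℝ, ∀ (j : Fin (m + 1)) r, W j r = w (r, j) :=
      ⟨fun j r => if hj : j < m + 1 then w (r, ⟨j, hj⟩) else 0, fun j r => dif_pos j.isLt⟩
    refine ⟨_, ⟨W, by simp [Sat], fun j i l hl => ?_⟩, rfl⟩
    rw [glue_corner hW, glue_corner hW]
    exact hw (i, j) _ ⟨l, rfl⟩ fun h => hl (cell_injective _ h)

theorem Qpolytope_succ (m : ℕ) :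
    Qpolytope (m + 1) = ∑ h : Fin 2 × Fin m, coordSimplex (Set.range (cell h)) := by
  rw [Fintype.sum_prod_type]
  refine Finset.sum_congr rfl fun i _ => Finset.sum_congr rfl fun j _ => ?_
  have hrange : Set.range (cell (i, j)) = {(i.castSucc, j.castSucc), (i.castSucc, j.succ),
      (i.succ, j.castSucc), (i.succ, j.succ)} := by
    ext p
    simp [cell, cornerRow, Fin.exists_fin_two, or_assoc, eq_comm]
  rw [hrange, coordSimplex, Set.image_insert_eq, Set.image_insert_eq, Set.image_pair]
  rfl

theorem numVerticesQ_succ (m : ℕ) : numVerticesQ (m + 1) = Nat.card (feasible [] m) := by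
  rw [numVerticesQ, Qpolytope_succ, card_extremePoints_sum_coordSimplex, ← image_heads_feasible,
    Nat.card_image_of_injective (heads_injective m)]

end Grid

/-- `V_n` equals the entry in row 5, column 6 (1-indexed) of the `n`-th power of
the 6×6 matrix `B`. -/
theorem numVerticesQ_eq_matrix_power_entry
    (B : Matrix (Fin 6) (Fin 6) ℤ)
    (hB : B = !![2, 2, 1, 1, 1, 1;
                 2, 3, 1, 1, 2, 1;
                 2, 2, 1, 2, 1, 1;
                 2, 3, 1, 2, 2, 1;
                 2, 4, 1, 2, 4, 1;
                 2, 2, 1, 0, 1, 1]) :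
    ∀ n : ℕ, 2 ≤ n → (numVerticesQ n : ℤ) = (B ^ n) 4 5 := by
  intro n hn
  obtain ⟨m, rfl⟩ : ∃ m, n = m + 1 := ⟨n - 1, by omega⟩
  obtain rfl : B = transferMatrix := hB
  have hcol : (fun k => transferMatrix k 5) = 1 := by decide
  rw [numVerticesQ_succ, card_feasible m ([], 4) (by simp [classes]), pow_succ, Matrix.mul_apply,
    Matrix.mulVec, dotProduct, ← hcol]
end
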